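/- Each curve of 𝒞^4 contains a curve of 𝒞^2 which passes 3 times through some point, i.e. some point of ℤ^3 occurs three times among the endpoints of the segments of that curve of 𝒞^2. -/

import Mathlib

namespace Folding

noncomputable section

open Set

/-- Points of `ℝ^n` with the euclidean distance. -/
abbrev Pt (n : ℕ) := EuclideanSpace ℝ (Fin n)

/-- `p` is a point of the lattice `ℤ^n`. -/
def latt {n : ℕ} (p : Pt n) : Prop := ∀ i, ∃ m : ℤ, p i = (m : ℝ)

/-- `p` belongs to `m·ℤ^n`. -/
def inLat {n : ℕ} (m : ℕ) (p : Pt n) : Prop := ∀ i, ∃ c : ℤ, p i = (m : ℝ) * (c : ℝ)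

/-- The canonical basis vector `e_i`. -/
def uvec (n : ℕ) (i : Fin n) : Pt n := EuclideanSpace.single i (1 : ℝ)

/-- `u` belongs to `E = {e_1, -e_1, …, e_n, -e_n}`. -/
def IsDir {n : ℕ} (u : Pt n) : Prop := ∃ i, u = uvec n i ∨ u = -uvec n i

/-- A (nonoriented) lattice segment `[x, x + e_i]`, as an unordered pair of endpoints. -/
def IsSeg {n : ℕ} (S : Sym2 (Pt n)) : Prop := ∃ x i, latt x ∧ S = s(x, x + uvec n i)

/-- A curve: a sequence of segments, indexed by an interval of `ℤ` (finite, ℕ-like or ℤ-like),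
recorded through its sequence of vertices; two consecutive segments have exactly one common
endpoint, and the common endpoints with the preceding and the following segments differ
(`noback`). -/
structure Curve (n : ℕ) where
  dom : Set ℤ
  ordConn : dom.OrdConnected
  nontriv : ∃ i, i ∈ dom ∧ i + 1 ∈ dom
  v : ℤ → Pt n
  lattice : ∀ i ∈ dom, latt (v i)
  step : ∀ i : ℤ, i ∈ dom → i + 1 ∈ dom →
    ∃ j, v (i + 1) = v i + uvec n j ∨ v (i + 1) = v i - uvec n j
  noback : ∀ i : ℤ, i - 1 ∈ dom → i + 1 ∈ dom → v (i + 1) ≠ v (i - 1)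

namespace Curve

variable {n : ℕ} (c : Curve n)

/-- The segments of a curve. -/
def segs : Set (Sym2 (Pt n)) :=
  {S | ∃ i : ℤ, i ∈ c.dom ∧ i + 1 ∈ c.dom ∧ S = s(c.v i, c.v (i + 1))}

/-- The connexions between segments of a curve: pairs of consecutive segments. -/
def conn (S T : Sym2 (Pt n)) : Prop :=
  ∃ i : ℤ, i - 1 ∈ c.dom ∧ i + 1 ∈ c.dom ∧
    ((S = s(c.v (i - 1), c.v i) ∧ T = s(c.v i, c.v (i + 1))) ∨
     (T = s(c.v (i - 1), c.v i) ∧ S = s(c.v i, c.v (i + 1))))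

/-- A curve is self-avoiding if each of its segments appears only once. -/
def SelfAvoiding : Prop :=
  ∀ i j : ℤ, i ∈ c.dom → i + 1 ∈ c.dom → j ∈ c.dom → j + 1 ∈ c.dom →
    s(c.v i, c.v (i + 1)) = s(c.v j, c.v (j + 1)) → i = j

/-- A curve without endpoints (indexed by `ℤ`). -/
def NoEndpts : Prop := c.dom = Set.univ

/-- `p` is an endpoint of the curve `c`. -/
def IsEndpt (p : Pt n) : Prop :=
  ∃ i ∈ c.dom, p = c.v i ∧ (i - 1 ∉ c.dom ∨ i + 1 ∉ c.dom)

/-- `S` is the end segment of `c` at its endpoint `p`. -/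
def endSegAt (p : Pt n) (S : Sym2 (Pt n)) : Prop :=
  ∃ i : ℤ, i ∈ c.dom ∧ p = c.v i ∧
    ((i - 1 ∉ c.dom ∧ i + 1 ∈ c.dom ∧ S = s(c.v i, c.v (i + 1))) ∨
     (i + 1 ∉ c.dom ∧ i - 1 ∈ c.dom ∧ S = s(c.v (i - 1), c.v i)))

/-- The number of segments (length) of a curve. -/
def nsegs : ℕ := {i : ℤ | i ∈ c.dom ∧ i + 1 ∈ c.dom}.ncard

end Curve

/-- The trace of a set of curves: its set of segments together with the connexion
relation between segments.  Two sets of curves are geometrically the same set of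
(nonoriented) curves iff they have the same trace. -/
structure Trace (n : ℕ) where
  segs : Set (Sym2 (Pt n))
  conn : Sym2 (Pt n) → Sym2 (Pt n) → Prop

def curveTrace {n : ℕ} (c : Curve n) : Trace n := ⟨c.segs, c.conn⟩

def traceOf {n : ℕ} (E : Set (Curve n)) : Trace n :=
  ⟨{S | ∃ c ∈ E, S ∈ c.segs}, fun S T => ∃ c ∈ E, c.conn S T⟩

/-- Two curves are the same nonoriented curve. -/
def SameCurve {n : ℕ} (c d : Curve n) : Prop := c.segs = d.segs ∧ c.conn = d.conn

/-- A set of pairwise disjoint self-avoiding curves. -/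
def DisjSA {n : ℕ} (E : Set (Curve n)) : Prop :=
  (∀ c ∈ E, c.SelfAvoiding) ∧
  ∀ c ∈ E, ∀ d ∈ E, ¬ SameCurve c d → ∀ S, S ∈ c.segs → S ∉ d.segs

/-- The set of points of `ℝ^n` lying on the segment `S`. -/
def segPts {n : ℕ} (S : Sym2 (Pt n)) : Set (Pt n) :=
  {p | ∃ a b, S = s(a, b) ∧ ∃ t : ℝ, 0 ≤ t ∧ t ≤ 1 ∧ p = a + t • (b - a)}

def Trace.pts {n : ℕ} (T : Trace n) : Set (Pt n) := ⋃ S ∈ T.segs, segPts S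

/-- A set of curves covers `X ⊆ ℝ^n`: each lattice segment containing a point of `X`
appears in one and only one of the curves. -/
def Covers {n : ℕ} (E : Set (Curve n)) (X : Set (Pt n)) : Prop :=
  ∀ S, IsSeg S → (segPts S ∩ X).Nonempty →
    (∃ c ∈ E, S ∈ c.segs) ∧ ∀ c ∈ E, ∀ d ∈ E, S ∈ c.segs → S ∈ d.segs → SameCurve c d

/-- A covering of `ℝ^n` by disjoint self-avoiding curves. -/
def IsCovering {n : ℕ} (E : Set (Curve n)) : Prop := DisjSA E ∧ Covers E Set.univ

/-- A single curve covers `X`. -/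
def CurveCovers {n : ℕ} (c : Curve n) (X : Set (Pt n)) : Prop :=
  ∀ S, IsSeg S → (segPts S ∩ X).Nonempty → S ∈ c.segs

/-- `b` is a curve contained in the curve `a`. -/
def SubCurve {n : ℕ} (b a : Curve n) : Prop :=
  b.segs ⊆ a.segs ∧ ∀ S T, b.conn S T → a.conn S T

/-- The relation `≺` at the level of traces. -/
def TPrec {n : ℕ} (T T' : Trace n) : Prop :=
  T.segs ⊆ T'.segs ∧ ∀ S S', T.conn S S' → T'.conn S S'

/-- `E ≺ F` : each segment of a curve of `E` is a segment of a curve of `F` and each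
connexion between two segments of a curve of `E` also exists in `F`. -/
def Prec {n : ℕ} (E F : Set (Curve n)) : Prop := TPrec (traceOf E) (traceOf F)

/-- Image of a trace under a map of `ℝ^n`. -/
def Trace.map {n : ℕ} (f : Pt n → Pt n) (T : Trace n) : Trace n :=
  ⟨Sym2.map f '' T.segs,
   fun S S' => ∃ A B, T.conn A B ∧ S = Sym2.map f A ∧ S' = Sym2.map f B⟩

/-- Translation of a trace by the vector `t`. -/
def Trace.transl {n : ℕ} (t : Pt n) (T : Trace n) : Trace n := T.map (fun p => p + t)

/-- Property (H) for the pair `(k, l)`. -/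
def SatH {n : ℕ} (A : Set (Curve n)) (k l : ℕ) : Prop :=
  0 < k ∧ 0 < l ∧ k ∣ l ∧ IsCovering A ∧
  (∀ c ∈ A, c.dom.Finite ∧ ∃ x i, latt x ∧ inLat k x ∧ c.IsEndpt x ∧
      c.IsEndpt (x + (k : ℝ) • uvec n i) ∧
      ∀ p, c.IsEndpt p → p = x ∨ p = x + (k : ℝ) • uvec n i) ∧
  (∀ (x : Pt n) (i : Fin n), latt x → inLat k x →
      (∃ c ∈ A, c.IsEndpt x ∧ c.IsEndpt (x + (k : ℝ) • uvec n i)) ∧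
      ∀ c ∈ A, ∀ d ∈ A, c.IsEndpt x → c.IsEndpt (x + (k : ℝ) • uvec n i) →
        d.IsEndpt x → d.IsEndpt (x + (k : ℝ) • uvec n i) → SameCurve c d) ∧
  (∀ t : Pt n, inLat l t → Trace.transl t (traceOf A) = traceOf A)

/-- The trace of the convolution product `A ∗ B`, where `A` satisfies (H) for `(k, l)`:
apply to `B` the homothety of center `0` and ratio `k`, then replace each resulting
segment by the curve of `A` having the same endpoints (connexions come from the curves
of `A`, together with the junctions of the end segments of consecutive `A`-curves). -/
def ConvTrace {n : ℕ} (k : ℕ) (A B : Set (Curve n)) : Trace n where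
  segs := {S | ∃ a b : Pt n, s(a, b) ∈ (traceOf B).segs ∧
    ∃ c ∈ A, c.IsEndpt ((k : ℝ) • a) ∧ c.IsEndpt ((k : ℝ) • b) ∧ S ∈ c.segs}
  conn := fun S S' =>
    (∃ a b : Pt n, s(a, b) ∈ (traceOf B).segs ∧
      ∃ c ∈ A, c.IsEndpt ((k : ℝ) • a) ∧ c.IsEndpt ((k : ℝ) • b) ∧ c.conn S S') ∨
    (∃ a b d : Pt n, (traceOf B).conn s(a, b) s(b, d) ∧
      ∃ c ∈ A, ∃ c' ∈ A, c.IsEndpt ((k : ℝ) • a) ∧ c.IsEndpt ((k : ℝ) • b) ∧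
        c'.IsEndpt ((k : ℝ) • b) ∧ c'.IsEndpt ((k : ℝ) • d) ∧
        ((c.endSegAt ((k : ℝ) • b) S ∧ c'.endSegAt ((k : ℝ) • b) S') ∨
         (c.endSegAt ((k : ℝ) • b) S' ∧ c'.endSegAt ((k : ℝ) • b) S)))

/-- The two-sided identity of the convolution product: the covering consisting of all
curves with one segment. -/
def unitTrace (n : ℕ) : Trace n := ⟨{S | IsSeg S}, fun _ _ => False⟩

/-- `P s` realizes the power `A^s` for the convolution product. -/
def PowersOf {n : ℕ} (A : Set (Curve n)) (k : ℕ) (P : ℕ → Set (Curve n)) : Prop :=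
  (∀ s, DisjSA (P s)) ∧ traceOf (P 0) = unitTrace n ∧
  ∀ s, traceOf (P (s + 1)) = ConvTrace k A (P s)

/-- The trace of `Â`, the inductive limit of the `A^s` for `≺`. -/
def hatTrace {n : ℕ} (P : ℕ → Set (Curve n)) : Trace n :=
  ⟨{S | ∃ s, S ∈ (traceOf (P s)).segs}, fun S T => ∃ s, (traceOf (P s)).conn S T⟩

/-- A pairing relation on `E = {e_1, -e_1, …, e_n, -e_n}`. -/
def IsPairing {n : ℕ} (R : Pt n → Pt n → Prop) : Prop :=
  (∀ u v, R u v → R v u) ∧ (∀ u v, R u v → IsDir u ∧ IsDir v) ∧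
  (∀ u, ¬ R u u) ∧ ∀ u, IsDir u → ∃! v, R u v

/-- The trace of `Â_R` : `Â` with the segments with endpoint `0` connected according
to `R`. -/
def hatRTrace {n : ℕ} (P : ℕ → Set (Curve n)) (R : Pt n → Pt n → Prop) : Trace n :=
  ⟨(hatTrace P).segs,
   fun S T => (hatTrace P).conn S T ∨
     ∃ u v, R u v ∧ S = s((0 : Pt n), u) ∧ T = s((0 : Pt n), v)⟩

/-- The cube `P_{x,h}`. -/
def cube {n : ℕ} (x : Pt n) (h : ℕ) : Set (Pt n) :=
  {p | ∀ i, x i - h ≤ p i ∧ p i ≤ x i + h}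

/-- Restriction of a trace to a region `X` of `ℝ^n`. -/
def Trace.restr {n : ℕ} (T : Trace n) (X : Set (Pt n)) : Trace n :=
  ⟨{S | S ∈ T.segs ∧ segPts S ⊆ X},
   fun S S' => T.conn S S' ∧ segPts S ⊆ X ∧ segPts S' ⊆ X⟩

/-- Condition (C). -/
def CondC {n : ℕ} (T : Trace n) : Prop :=
  ∀ (x : Pt n) (h : ℕ), latt x → 1 ≤ h →
    ∃ y : Pt n, latt y ∧ y ∉ cube x h ∧
      Trace.transl (y - x) (T.restr (cube x h)) = T.restr (cube y h)

/-- `(B(x,r) ∩ T, x) ≅ (B(y,r) ∩ T', y)` : the translation sending `x` to `y` maps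
the part of `T` in the closed ball `B(x,r)` onto the part of `T'` in `B(y,r)`,
preserving the connexions between segments. -/
def BallIso {n : ℕ} (T : Trace n) (x : Pt n) (T' : Trace n) (y : Pt n) (r : ℝ) : Prop :=
  (fun p => p + (y - x)) '' (T.pts ∩ Metric.closedBall x r) =
      T'.pts ∩ Metric.closedBall y r ∧
  (∀ S S', T.conn S S' → segPts S ⊆ Metric.closedBall x r →
      segPts S' ⊆ Metric.closedBall x r →
      T'.conn (Sym2.map (fun p => p + (y - x)) S) (Sym2.map (fun p => p + (y - x)) S')) ∧
  (∀ S S', T'.conn S S' → segPts S ⊆ Metric.closedBall y r →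
      segPts S' ⊆ Metric.closedBall y r →
      T.conn (Sym2.map (fun p => p + (x - y)) S) (Sym2.map (fun p => p + (x - y)) S'))

/-- The local isomorphism property. -/
def LocIsoProp {n : ℕ} (T : Trace n) : Prop :=
  ∀ (x : Pt n) (r : ℝ), 0 ≤ r →
    ∃ t : ℝ, 0 ≤ t ∧ ∀ y : Pt n, ∃ z ∈ Metric.closedBall y t, BallIso T x T z r

/-- Two traces are locally isomorphic. -/
def LocallyIso {n : ℕ} (T T' : Trace n) : Prop :=
  (∀ (x : Pt n) (r : ℝ), 0 ≤ r → ∃ y, BallIso T x T' y r) ∧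
  (∀ (y : Pt n) (r : ℝ), 0 ≤ r → ∃ x, BallIso T' y T x r)

/-- `Ω_{s,x}` : suppress the connexions between segments whose common endpoint lies in
`x + k^s ℤ^n`. -/
def OmegaTrace {n : ℕ} (k s : ℕ) (x : Pt n) (T : Trace n) : Trace n :=
  ⟨T.segs, fun S S' => T.conn S S' ∧ ¬ ∃ p, p ∈ S ∧ p ∈ S' ∧ inLat (k ^ s) (p - x)⟩

/-- `Σ_{s,x}(E)` : for each curve `D` of `E` passing through `x`, the curve(s) with
endpoint `x` contained in `D` having maximal length, this length being limited to
`8^s`. -/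
def SigmaSet {n : ℕ} (s : ℕ) (x : Pt n) (E : Set (Curve n)) : Set (Curve n) :=
  {b | ∃ D ∈ E, SubCurve b D ∧ b.IsEndpt x ∧ b.nsegs ≤ 8 ^ s ∧
    ∀ b' : Curve n, SubCurve b' D → b'.IsEndpt x → b'.nsegs ≤ 8 ^ s →
      SubCurve b b' → SameCurve b b'}

/-- A positive (orientation preserving) isometry of `ℝ^n`. -/
def PosIsom {n : ℕ} (f : Pt n → Pt n) : Prop :=
  ∃ (g : Pt n ≃ₗᵢ[ℝ] Pt n) (t : Pt n), (∀ x, f x = g x + t) ∧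
    0 < LinearMap.det (g.toLinearEquiv.toLinearMap)

/-- `E` consists of exactly `m` curves. -/
def HasExactly {n : ℕ} (E : Set (Curve n)) (m : ℕ) : Prop :=
  ∃ L : List (Curve n), L.length = m ∧ (∀ c ∈ L, c ∈ E) ∧
    L.Pairwise (fun c d => ¬ SameCurve c d) ∧ ∀ c ∈ E, ∃ d ∈ L, SameCurve c d

/-- `E` consists of at most `m` curves. -/
def AtMost {n : ℕ} (E : Set (Curve n)) (m : ℕ) : Prop :=
  ∃ L : List (Curve n), L.length ≤ m ∧ ∀ c ∈ E, ∃ d ∈ L, SameCurve c d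

/-- The set of points of a curve. -/
def curvePts {n : ℕ} (c : Curve n) : Set (Pt n) := ⋃ S ∈ c.segs, segPts S

-- ℝ³-specific part
def toPt3 (f : Fin 3 → ℝ) : Pt 3 := (WithLp.equiv 2 (Fin 3 → ℝ)).symm f

def p3 (a b c : ℤ) : Pt 3 := toPt3 ![(a : ℝ), (b : ℝ), (c : ℝ)]

/-- The vertices of the curve `C`. -/
def CList : List (Pt 3) :=
  [p3 0 0 0, p3 0 (-1) 0, p3 0 (-1) (-1), p3 0 0 (-1), p3 1 0 (-1),
   p3 1 (-1) (-1), p3 1 (-1) 0, p3 1 0 0, p3 2 0 0]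

/-- The block `ℬ₀` : six curves given by their lists of successive vertices. -/
def B0 : List (List (Pt 3)) :=
  [ CList,
    [p3 0 0 0, p3 0 0 1, p3 0 1 1, p3 0 1 0, p3 (-1) 1 0, p3 (-1) 1 1,
     p3 (-1) 0 1, p3 (-1) 0 0, p3 (-2) 0 0],
    [p3 0 0 0, p3 0 0 (-1), p3 (-1) 0 (-1), p3 (-1) 0 0, p3 (-1) 1 0,
     p3 (-1) 1 (-1), p3 0 1 (-1), p3 0 1 0, p3 0 2 0],
    [p3 0 0 0, p3 1 0 0, p3 1 0 1, p3 0 0 1, p3 0 (-1) 1, p3 1 (-1) 1,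
     p3 1 (-1) 0, p3 0 (-1) 0, p3 0 (-2) 0],
    [p3 0 0 0, p3 (-1) 0 0, p3 (-1) (-1) 0, p3 0 (-1) 0, p3 0 (-1) 1,
     p3 (-1) (-1) 1, p3 (-1) 0 1, p3 0 0 1, p3 0 0 2],
    [p3 0 0 0, p3 0 1 0, p3 1 1 0, p3 1 0 0, p3 1 0 (-1), p3 1 1 (-1),
     p3 0 1 (-1), p3 0 0 (-1), p3 0 0 (-2)] ]

def sigma3 : Pt 3 → Pt 3 := fun x => toPt3 ![x 0, -(x 1), -(x 2)]
def tau3 : Pt 3 → Pt 3 := fun x => toPt3 ![x 0, x 2, -(x 1)]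
def ups3 : Pt 3 → Pt 3 := fun x => toPt3 ![x 0, -(x 2), x 1]

/-- The four blocks `ℬ₀, ℬ₁, ℬ₂, ℬ₃`. -/
def blockLists : Fin 4 → List (List (Pt 3)) :=
  ![B0,
    B0.map (List.map fun p => p3 2 2 0 + sigma3 p),
    B0.map (List.map fun p => p3 2 0 2 + tau3 p),
    B0.map (List.map fun p => p3 0 2 2 + ups3 p)]

def listSegs (L : List (Pt 3)) : Set (Sym2 (Pt 3)) :=
  {S | ∃ j : ℕ, j + 1 < L.length ∧ S = s(L.getD j 0, L.getD (j + 1) 0)}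

def listConn (L : List (Pt 3)) (S T : Sym2 (Pt 3)) : Prop :=
  ∃ j : ℕ, j + 2 < L.length ∧
    ((S = s(L.getD j 0, L.getD (j + 1) 0) ∧ T = s(L.getD (j + 1) 0, L.getD (j + 2) 0)) ∨
     (T = s(L.getD j 0, L.getD (j + 1) 0) ∧ S = s(L.getD (j + 1) 0, L.getD (j + 2) 0)))

/-- The trace of the curve given by a list of successive vertices. -/
def listTrace (L : List (Pt 3)) : Trace 3 := ⟨listSegs L, listConn L⟩

/-- The trace of the covering `𝒞 = ⋃_{u ∈ ℤ³, 0 ≤ i ≤ 3} (4u + ℬ_i)`. -/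
def CTrace : Trace 3 where
  segs := {S | ∃ u : Pt 3, latt u ∧ ∃ (i : Fin 4), ∃ M ∈ blockLists i,
    S ∈ (Trace.transl ((4 : ℝ) • u) (listTrace M)).segs}
  conn := fun S T => ∃ u : Pt 3, latt u ∧ ∃ (i : Fin 4), ∃ M ∈ blockLists i,
    (Trace.transl ((4 : ℝ) • u) (listTrace M)).conn S T

open Classical in
/-- The permutation `θ` of `E` with `θ(e₁) = -e₂`, `θ(e₂) = -e₃`, `θ(e₃) = -e₁`
and `θ² = Id`. -/
def theta3 : Pt 3 → Pt 3 := fun u =>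
  if u = uvec 3 0 then -uvec 3 1
  else if u = -uvec 3 1 then uvec 3 0
  else if u = uvec 3 1 then -uvec 3 2
  else if u = -uvec 3 2 then uvec 3 1
  else if u = uvec 3 2 then -uvec 3 0
  else if u = -uvec 3 0 then uvec 3 2
  else u

/-- `R^θ`. -/
def Rtheta (R : Pt 3 → Pt 3 → Prop) : Pt 3 → Pt 3 → Prop :=
  fun u v => R (theta3 u) (theta3 v)

def Rx (P : ℕ → Set (Curve 3)) (x : Pt 3) : Pt 3 → Pt 3 → Prop :=
  fun u v => (hatTrace P).conn s(x, x + u) s(x, x + v)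

/-- Condition (P). -/
def SatP (P : ℕ → Set (Curve 3)) (R : Pt 3 → Pt 3 → Prop) : Prop :=
  ∃ x : Pt 3, (∀ i, x i = -2 ∨ x i = 0 ∨ x i = 2 ∨ x i = 4) ∧
    (¬ ∀ i, x i = 0 ∨ x i = 4) ∧ (Rx P x = R ∨ Rx P x = Rtheta R)

/-- The trace of `Ĉ_X`, the inductive limit of the sets `x_s + 𝒞^s`. -/
def hatXTrace (P : ℕ → Set (Curve 3)) (x : ℕ → Pt 3) : Trace 3 :=
  ⟨{S | ∃ s, 1 ≤ s ∧ S ∈ (Trace.transl (x s) (traceOf (P s))).segs},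
   fun S T => ∃ s, 1 ≤ s ∧ (Trace.transl (x s) (traceOf (P s))).conn S T⟩

/-- The curve `c` is equivalent to `C` (image of `C` by a positive isometry). -/
def EquivToC (c : Curve 3) : Prop :=
  ∃ f, PosIsom f ∧ curveTrace c = Trace.map f (listTrace CList)

/-- `x` is an endpoint of type `0` (resp. `1`) of the curve `c`, for `c`
equivalent to `C`. -/
def EndptType (c : Curve 3) (x : Pt 3) (ty : ℕ) : Prop :=
  ∃ f, PosIsom f ∧ curveTrace c = Trace.map f (listTrace CList) ∧
    x = f (if ty = 0 then p3 0 0 0 else p3 2 0 0)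

/-- Integer points of `ℤ³`, used for explicit computations. -/
abbrev Z3 := ℤ × ℤ × ℤ

/-- The point of `ℝ³` with the given integer coordinates. -/
def toPt (v : Z3) : Pt 3 := p3 v.1 v.2.1 v.2.2

/-- Multiplication of an integer point by an integer. -/
def scale (m : ℤ) (v : Z3) : Z3 := (m * v.1, m * v.2.1, m * v.2.2)

/-- The three canonical unit vectors. -/
def unitZ : Fin 3 → Z3
  | 0 => (1, 0, 0)
  | 1 => (0, 1, 0)
  | 2 => (0, 0, 1)

/-- `x` and `y` are the endpoints of a lattice segment. -/
def AdjZ (x y : Z3) : Prop := ∃ i, y = x + unitZ i ∨ x = y + unitZ i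

theorem toPt_apply_zero (v : Z3) : toPt v 0 = v.1 := rfl
theorem toPt_apply_one (v : Z3) : toPt v 1 = v.2.1 := rfl
theorem toPt_apply_two (v : Z3) : toPt v 2 = v.2.2 := rfl

theorem pt_ext {p q : Pt 3} (h0 : p 0 = q 0) (h1 : p 1 = q 1) (h2 : p 2 = q 2) : p = q := by
  ext i
  fin_cases i
  exacts [h0, h1, h2]

theorem toPt_injective : Function.Injective toPt := by
  intro v w h
  have h0 : toPt v 0 = toPt w 0 := by rw [h]
  have h1 : toPt v 1 = toPt w 1 := by rw [h]
  have h2 : toPt v 2 = toPt w 2 := by rw [h]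
  simp only [toPt_apply_zero, toPt_apply_one, toPt_apply_two, Int.cast_inj] at h0 h1 h2
  exact Prod.ext h0 (Prod.ext h1 h2)

theorem toPt_add (v w : Z3) : toPt (v + w) = toPt v + toPt w := by
  apply pt_ext <;> simp [toPt_apply_zero, toPt_apply_one, toPt_apply_two]

theorem toPt_zero : toPt 0 = 0 := by
  apply pt_ext <;> simp [toPt_apply_zero, toPt_apply_one, toPt_apply_two]

theorem toPt_scale (m : ℤ) (v : Z3) : toPt (scale m v) = (m : ℝ) • toPt v := by
  apply pt_ext <;> simp [toPt_apply_zero, toPt_apply_one, toPt_apply_two, scale]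

theorem toPt_unitZ (i : Fin 3) : toPt (unitZ i) = uvec 3 i := by
  fin_cases i <;> apply pt_ext <;>
    simp [toPt_apply_zero, toPt_apply_one, toPt_apply_two, unitZ, uvec]

theorem latt_toPt (v : Z3) : latt (toPt v) := by
  intro i
  fin_cases i
  exacts [⟨_, rfl⟩, ⟨_, rfl⟩, ⟨_, rfl⟩]

theorem exists_toPt_of_latt {p : Pt 3} (h : latt p) : ∃ v, p = toPt v := by
  obtain ⟨a, ha⟩ := h 0
  obtain ⟨b, hb⟩ := h 1
  obtain ⟨c, hc⟩ := h 2
  exact ⟨(a, b, c), pt_ext ha hb hc⟩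

theorem inLat_toPt_scale (m : ℕ) (v : Z3) : inLat m (toPt (scale m v)) := by
  intro i
  rw [toPt_scale]
  obtain ⟨c, hc⟩ := latt_toPt v i
  exact ⟨c, by simp [hc]⟩

theorem exists_toPt_of_inLat {m : ℕ} {p : Pt 3} (h : inLat m p) :
    ∃ v, p = (m : ℝ) • toPt v := by
  choose c hc using h
  exact ⟨(c 0, c 1, c 2), pt_ext (by simp [hc, toPt_apply_zero]) (by simp [hc, toPt_apply_one])
    (by simp [hc, toPt_apply_two])⟩

theorem AdjZ.symm {x y : Z3} (h : AdjZ x y) : AdjZ y x := by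
  obtain ⟨i, h | h⟩ := h
  exacts [⟨i, Or.inr h⟩, ⟨i, Or.inl h⟩]

namespace Curve

variable {n : ℕ} {c : Curve n}

theorem conn_symm {S T : Sym2 (Pt n)} (h : c.conn S T) : c.conn T S := by
  obtain ⟨i, h1, h2, h | h⟩ := h
  exacts [⟨i, h1, h2, Or.inr h⟩, ⟨i, h1, h2, Or.inl h⟩]

theorem mem_dom_of_between {i j k : ℤ} (hi : i ∈ c.dom) (hk : k ∈ c.dom) (hij : i ≤ j)
    (hjk : j ≤ k) : j ∈ c.dom :=
  c.ordConn.out hi hk ⟨hij, hjk⟩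

theorem mem_segs_of_conn_left {S T : Sym2 (Pt n)} (h : c.conn S T) : S ∈ c.segs := by
  obtain ⟨i, h1, h2, ⟨h, -⟩ | ⟨-, h⟩⟩ := h
  · have hi := mem_dom_of_between h1 h2 (j := i) (by lia) (by lia)
    exact ⟨i - 1, h1, by simpa using hi, by simpa using h⟩
  · have hi := mem_dom_of_between h1 h2 (j := i) (by lia) (by lia)
    exact ⟨i, hi, h2, h⟩

theorem mem_segs_of_conn_right {S T : Sym2 (Pt n)} (h : c.conn S T) : T ∈ c.segs :=
  mem_segs_of_conn_left (conn_symm h)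

theorem v_ne_succ {i : ℤ} (h : i ∈ c.dom) (h' : i + 1 ∈ c.dom) : c.v (i + 1) ≠ c.v i := by
  obtain ⟨j, hj | hj⟩ := c.step i h h' <;> rw [hj] <;> simp [uvec, sub_eq_add_neg]

/-- Two vertices at distance one in the sequence, in either direction. -/
theorem v_ne_of_step {i e : ℤ} (he : e = 1 ∨ e = -1) (h : i ∈ c.dom) (h' : i + e ∈ c.dom) :
    c.v (i + e) ≠ c.v i := by
  rcases he with rfl | rfl
  · exact v_ne_succ h h'
  · have := v_ne_succ h' (by simpa using h)
    simpa using this.symm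

theorem seg_mem {i e : ℤ} (he : e = 1 ∨ e = -1) (h : i ∈ c.dom) (h' : i + e ∈ c.dom) :
    s(c.v i, c.v (i + e)) ∈ c.segs := by
  rcases he with rfl | rfl
  · exact ⟨i, h, h', rfl⟩
  · exact ⟨i + -1, h', by simpa using h, by simp [Sym2.eq_swap]⟩

theorem conn_mem {i e : ℤ} (he : e = 1 ∨ e = -1) (h : i ∈ c.dom) (h' : i + 2 * e ∈ c.dom) :
    c.conn s(c.v i, c.v (i + e)) s(c.v (i + e), c.v (i + 2 * e)) := by
  rcases he with rfl | rfl
  · exact ⟨i + 1, by simpa using h, by simpa [add_assoc] using h',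
      Or.inl ⟨by simp, by simp [add_assoc]⟩⟩
  · refine ⟨i + -1, by simpa [sub_eq_add_neg, add_assoc] using h', by simpa using h,
      Or.inr ⟨?_, ?_⟩⟩
    · rw [Sym2.eq_swap, show i + 2 * -1 = i + -1 - 1 by ring]
    · rw [Sym2.eq_swap]; simp

/-- The index of a segment of a self-avoiding curve, together with its direction,
is determined by the segment. -/
theorem SelfAvoiding.index_eq (hc : c.SelfAvoiding) {i j e f : ℤ} (he : e = 1 ∨ e = -1)
    (hf : f = 1 ∨ f = -1) (hi : i ∈ c.dom) (hi' : i + e ∈ c.dom) (hj : j ∈ c.dom)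
    (hj' : j + f ∈ c.dom) (h : s(c.v i, c.v (i + e)) = s(c.v j, c.v (j + f))) :
    (i = j ∧ e = f) ∨ (i = j + f ∧ e = -f) := by
  rcases he with rfl | rfl <;> rcases hf with rfl | rfl
  · have := hc i j hi hi' hj hj' h
    lia
  · have := hc i (j + -1) hi hi' hj' (by simpa using hj) (by rw [h, Sym2.eq_swap]; simp)
    lia
  · have := hc (i + -1) j hi' (by simpa using hi) hj hj' (by rw [← h, Sym2.eq_swap]; simp)
    lia
  · have := hc (i + -1) (j + -1) hi' (by simpa using hi) hj' (by simpa using hj)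
      (by simp only [neg_add_cancel_right]; rw [Sym2.eq_swap, h, Sym2.eq_swap])
    lia

theorem exists_index_of_conn {S T : Sym2 (Pt n)} (h : c.conn S T) :
    ∃ i e : ℤ, (e = 1 ∨ e = -1) ∧ i ∈ c.dom ∧ i + e ∈ c.dom ∧ i + 2 * e ∈ c.dom ∧
      S = s(c.v i, c.v (i + e)) ∧ T = s(c.v (i + e), c.v (i + 2 * e)) := by
  obtain ⟨i, h1, h2, ⟨hS, hT⟩ | ⟨hT, hS⟩⟩ := h
  · have hi := mem_dom_of_between h1 h2 (j := i) (by lia) (by lia)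
    have e1 : i - 1 + 1 = i := by ring
    have e2 : i - 1 + 2 * 1 = i + 1 := by ring
    exact ⟨i - 1, 1, Or.inl rfl, h1, by rwa [e1], by rwa [e2], by rw [hS, e1],
      by rw [hT, e1, e2]⟩
  · have hi := mem_dom_of_between h1 h2 (j := i) (by lia) (by lia)
    have e1 : i + 1 + -1 = i := by ring
    have e2 : i + 1 + 2 * -1 = i - 1 := by ring
    exact ⟨i + 1, -1, Or.inr rfl, h2, by rwa [e1], by rwa [e2],
      by rw [hS, e1, Sym2.eq_swap], by rw [hT, e1, e2, Sym2.eq_swap]⟩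

theorem v_add_two_ne {i e : ℤ} (he : e = 1 ∨ e = -1) (h : i ∈ c.dom)
    (h' : i + 2 * e ∈ c.dom) : c.v (i + 2 * e) ≠ c.v i := by
  rcases he with rfl | rfl
  · have := c.noback (i + 1) (by simpa using h) (by simpa [add_assoc] using h')
    simpa [add_assoc] using this
  · have := c.noback (i + -1) (by simpa [sub_eq_add_neg, add_assoc] using h') (by simpa using h)
    simpa [sub_eq_add_neg, add_assoc] using this.symm

end Curve

section Paths

variable {n : ℕ} {E F : Set (Curve n)}

theorem SameCurve.symm {c d : Curve n} (h : SameCurve c d) : SameCurve d c :=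
  ⟨h.1.symm, h.2.symm⟩

theorem DisjSA.sameCurve (hE : DisjSA E) {c d : Curve n} (hc : c ∈ E) (hd : d ∈ E)
    {S : Sym2 (Pt n)} (h : S ∈ c.segs) (h' : S ∈ d.segs) : SameCurve c d := by
  by_contra hcd
  exact hE.2 c hc d hd hcd S h h'

theorem DisjSA.conn_of_mem (hE : DisjSA E) {c : Curve n} (hc : c ∈ E) {S T : Sym2 (Pt n)}
    (hS : S ∈ c.segs) (h : (traceOf E).conn S T) : c.conn S T := by
  obtain ⟨d, hd, hST⟩ := h
  rw [(hE.sameCurve hc hd hS (Curve.mem_segs_of_conn_left hST)).2]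
  exact hST

/-- The first `m` steps of `g` are successive segments of `T`, connected in `T`. -/
structure IsPath (T : Trace n) (g : ℕ → Pt n) (m : ℕ) : Prop where
  seg : ∀ j < m, s(g j, g (j + 1)) ∈ T.segs
  conn : ∀ j, j + 1 < m → T.conn s(g j, g (j + 1)) s(g (j + 1), g (j + 2))

theorem IsPath.exists_curve (hE : DisjSA E) {g : ℕ → Pt n} {m : ℕ} (hm : 1 ≤ m)
    (hg : IsPath (traceOf E) g m) :
    ∃ c ∈ E, ∃ k e : ℤ, (e = 1 ∨ e = -1) ∧
      ∀ j : ℕ, j ≤ m → k + e * j ∈ c.dom ∧ c.v (k + e * j) = g j := by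
  induction m, hm using Nat.le_induction with
  | base =>
    obtain ⟨c, hc, i, hi, hi', h⟩ := hg.seg 0 one_pos
    refine ⟨c, hc, ?_⟩
    rcases Sym2.eq_iff.1 h with ⟨h0, h1⟩ | ⟨h0, h1⟩
    · refine ⟨i, 1, Or.inl rfl, fun j hj => ?_⟩
      interval_cases j
      · simpa using ⟨hi, h0.symm⟩
      · simpa using ⟨hi', h1.symm⟩
    · refine ⟨i + 1, -1, Or.inr rfl, fun j hj => ?_⟩
      interval_cases j
      · simpa using ⟨hi', h0.symm⟩
      · simpa using ⟨hi, h1.symm⟩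
  | succ m hm ih =>
    obtain ⟨c, hc, k, e, he, h⟩ := ih ⟨fun j hj => hg.seg j (by lia), fun j hj =>
      hg.conn j (by lia)⟩
    refine ⟨c, hc, k, e, he, fun j hj => ?_⟩
    rcases Nat.lt_or_ge j (m + 1) with hj' | hj'
    · exact h j (by lia)
    obtain rfl : j = m + 1 := by lia
    clear hj hj'
    obtain ⟨l, rfl⟩ : ∃ l, m = l + 1 := ⟨m - 1, by lia⟩
    obtain ⟨d0, v0⟩ := h l (by lia)
    obtain ⟨d1, v1⟩ := h (l + 1) le_rfl
    have e1 : k + e * ((l + 1 : ℕ) : ℤ) = (k + e * l) + e := by push_cast; ring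
    have e2 : k + e * ((l + 1 + 1 : ℕ) : ℤ) = (k + e * l) + 2 * e := by push_cast; ring
    rw [e1] at d1 v1
    rw [e2]
    generalize k + e * (l : ℤ) = i at *
    have hconn := hg.conn l (by lia)
    rw [← v0, ← v1] at hconn
    obtain ⟨i', e', he', a0, a1, a2, hS, hT⟩ :=
      Curve.exists_index_of_conn (hE.conn_of_mem hc (Curve.seg_mem he d0 d1) hconn)
    rcases (hE.1 c hc).index_eq he he' d0 d1 a0 a1 hS with ⟨rfl, rfl⟩ | ⟨rfl, rfl⟩
    · exact ⟨a2, (Sym2.congr_right.1 hT).symm⟩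
    · exfalso
      rw [show i' + e' + -e' = i' by ring] at hT
      have hmem : c.v i' ∈ s(c.v (i' + e'), c.v (i' + 2 * e')) := by
        rw [← hT]; exact Sym2.mem_mk_left _ _
      rcases Sym2.mem_iff.1 hmem with h | h
      · exact Curve.v_ne_of_step he' a0 a1 h.symm
      · exact Curve.v_add_two_ne he' a0 a2 h.symm

/-- A curve of `E` sharing a segment with a curve of `F` is contained in it when `E ≺ F`. -/
theorem Prec.subCurve (hF : DisjSA F) (h : Prec E F) {b a : Curve n} (hb : b ∈ E) (ha : a ∈ F)
    {S : Sym2 (Pt n)} (hSb : S ∈ b.segs) (hSa : S ∈ a.segs) : SubCurve b a := by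
  obtain ⟨i, hi, hi', rfl⟩ := hSb
  have up : ∀ k : ℕ, i + k + 1 ∈ b.dom → s(b.v (i + k), b.v (i + k + 1)) ∈ a.segs := by
    intro k
    induction k with
    | zero => simpa using fun _ => hSa
    | succ k ih =>
      intro hk
      have e1 : i + ((k + 1 : ℕ) : ℤ) = i + k + 1 := by push_cast; ring
      have e2 : i + k + 1 + 1 = i + k + 2 * 1 := by ring
      rw [e1, e2] at hk ⊢
      have d0 := Curve.mem_dom_of_between hi hk (j := i + k) (by lia) (by lia)
      have d1 := Curve.mem_dom_of_between hi hk (j := i + k + 1) (by lia) (by lia)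
      exact Curve.mem_segs_of_conn_right (hF.conn_of_mem ha (ih d1)
        (h.2 _ _ ⟨b, hb, Curve.conn_mem (Or.inl rfl) d0 hk⟩))
  have down : ∀ k : ℕ, i - k ∈ b.dom → s(b.v (i - k), b.v (i - k + 1)) ∈ a.segs := by
    intro k
    induction k with
    | zero => simpa using fun _ => hSa
    | succ k ih =>
      intro hk
      have e1 : i - ((k + 1 : ℕ) : ℤ) = i - k - 1 := by push_cast; ring
      have e2 : i - k - 1 + 2 * 1 = i - k + 1 := by ring
      have e3 : i - (k : ℤ) - 1 + 1 = i - k := by ring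
      rw [e1] at hk ⊢
      have d0 := Curve.mem_dom_of_between hk hi (j := i - k) (by lia) (by lia)
      have d1 := Curve.mem_dom_of_between hk hi' (j := i - k + 1) (by lia) (by lia)
      have := Curve.conn_mem (Or.inl rfl) hk (by rwa [e2])
      rw [e2, e3] at this
      rw [e3]
      exact Curve.mem_segs_of_conn_right (hF.conn_of_mem ha (ih d0)
        (h.2 _ _ ⟨b, hb, Curve.conn_symm this⟩))
  have segs : b.segs ⊆ a.segs := by
    rintro _ ⟨j, hj, hj', rfl⟩
    rcases le_total i j with hij | hij
    · obtain ⟨k, rfl⟩ := Int.le.dest hij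
      exact up k hj'
    · obtain ⟨k, rfl⟩ := Int.le.dest hij
      simpa using down k (by simpa using hj)
  exact ⟨segs, fun S T hST => hF.conn_of_mem ha (segs (Curve.mem_segs_of_conn_left hST))
    (h.2 _ _ ⟨b, hb, hST⟩)⟩

end Paths

/-- The vertex lists of `ℬ₀` with integer coordinates. -/
def baseBlock : List (List Z3) :=
  [ [(0, 0, 0), (0, -1, 0), (0, -1, -1), (0, 0, -1), (1, 0, -1), (1, -1, -1), (1, -1, 0),
      (1, 0, 0), (2, 0, 0)],
    [(0, 0, 0), (0, 0, 1), (0, 1, 1), (0, 1, 0), (-1, 1, 0), (-1, 1, 1), (-1, 0, 1),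
      (-1, 0, 0), (-2, 0, 0)],
    [(0, 0, 0), (0, 0, -1), (-1, 0, -1), (-1, 0, 0), (-1, 1, 0), (-1, 1, -1), (0, 1, -1),
      (0, 1, 0), (0, 2, 0)],
    [(0, 0, 0), (1, 0, 0), (1, 0, 1), (0, 0, 1), (0, -1, 1), (1, -1, 1), (1, -1, 0),
      (0, -1, 0), (0, -2, 0)],
    [(0, 0, 0), (-1, 0, 0), (-1, -1, 0), (0, -1, 0), (0, -1, 1), (-1, -1, 1), (-1, 0, 1),
      (0, 0, 1), (0, 0, 2)],
    [(0, 0, 0), (0, 1, 0), (1, 1, 0), (1, 0, 0), (1, 0, -1), (1, 1, -1), (0, 1, -1),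
      (0, 0, -1), (0, 0, -2)] ]

/-- The representatives in `{0, 1}³` of the points of even coordinate sum modulo `2`. -/
def rep : Fin 4 → Z3
  | 0 => (0, 0, 0)
  | 1 => (1, 1, 0)
  | 2 => (1, 0, 1)
  | 3 => (0, 1, 1)

/-- The affine map sending `ℬ₀` onto the block with the given index. -/
def blockMap : Fin 4 → Z3 → Z3
  | 0 => fun v => v
  | 1 => fun v => (2, 2, 0) + (v.1, -v.2.1, -v.2.2)
  | 2 => fun v => (2, 0, 2) + (v.1, v.2.2, -v.2.1)
  | 3 => fun v => (0, 2, 2) + (v.1, -v.2.2, v.2.1)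

/-- The vertex lists of the four blocks with integer coordinates. -/
def blockZ (i : Fin 4) : List (List Z3) := baseBlock.map (List.map (blockMap i))

theorem blockLists_eq (i : Fin 4) : blockLists i = (blockZ i).map (List.map toPt) := by
  have h0 : B0 = baseBlock.map (List.map toPt) := by
    simp [B0, CList, baseBlock, toPt]
  have hmap : ∀ f : Pt 3 → Pt 3, (∀ v, f (toPt v) = toPt (blockMap i v)) →
      B0.map (List.map f) = (blockZ i).map (List.map toPt) := by
    intro f hf
    simp [h0, blockZ, List.map_map, Function.comp_def, hf]
  fin_cases i
  · simpa [blockLists] using hmap id fun v => rfl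
  all_goals
    refine hmap _ fun v => ?_
    apply pt_ext <;> simp [toPt_apply_zero, toPt_apply_one, toPt_apply_two, blockMap, p3,
      sigma3, tau3, ups3, toPt3]

/-- The index of the block whose center is congruent to `2x` modulo `4`, for `x` of even
coordinate sum. -/
def blockIdx (x : Z3) : Fin 4 :=
  if x.1 % 2 = 0 then (if x.2.1 % 2 = 0 then 0 else 3) else (if x.2.1 % 2 = 0 then 2 else 1)

/-- The list of the block `i` whose last vertex is `p`. -/
def blockTo (i : Fin 4) (p : Z3) : List Z3 :=
  ((blockZ i).find? fun M => M.getD 8 0 == p).getD []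

/-- Coordinatewise integer part of the half. -/
def halfZ (x : Z3) : Z3 := (x.1 / 2, x.2.1 / 2, x.2.2 / 2)

/-- The coordinate sum is even. -/
def EvenZ (x : Z3) : Prop := (x.1 + x.2.1 + x.2.2) % 2 = 0

instance (x : Z3) : Decidable (EvenZ x) := inferInstanceAs (Decidable (_ = _))

/-- The vertices of the curve of `𝒞` from `2x` to `2y`, for `x` of even coordinate sum. -/
def outVertex (x y : Z3) (j : ℕ) : Z3 :=
  scale 4 (halfZ x) +
    (blockTo (blockIdx x) (scale 2 (rep (blockIdx x) + (y - x)))).getD j 0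

/-- The vertices of the curve of `𝒞` from `2x` to `2y`. -/
def curveVertex (x y : Z3) (j : ℕ) : Z3 :=
  if j = 0 then scale 2 x else if EvenZ x then outVertex x y j else outVertex y x (8 - j)

/-- The vertices obtained from those of a path by applying the homothety of ratio `2` and
replacing the segments by curves of `𝒞`. -/
def refine (g : ℕ → Z3) (j : ℕ) : Z3 := curveVertex (g (j / 8)) (g (j / 8 + 1)) (j % 8)

theorem refine_shift (g : ℕ → Z3) (m : ℕ) :
    refine (fun k => g (m + k)) = fun k => refine g (8 * m + k) := by
  funext k
  simp only [refine]
  rw [show (8 * m + k) / 8 = m + k / 8 by lia, show (8 * m + k) % 8 = k % 8 by lia, add_assoc]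

theorem scale_add (m : ℤ) (v w : Z3) : scale m (v + w) = scale m v + scale m w := by
  simp [scale, mul_add]

theorem scale_scale (m n : ℤ) (v : Z3) : scale m (scale n v) = scale (m * n) v := by
  simp [scale, mul_assoc]

theorem outVertex_translate (q x y : Z3) (j : ℕ) :
    outVertex (scale 2 q + x) (scale 2 q + y) j = scale 4 q + outVertex x y j := by
  have h1 : halfZ (scale 2 q + x) = q + halfZ x := by
    ext <;> simp [halfZ, scale] <;> lia
  have h2 : blockIdx (scale 2 q + x) = blockIdx x := by
    simp [blockIdx, scale, Int.mul_add_emod_self_left]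
  rw [outVertex, outVertex, h1, h2, scale_add, add_sub_add_left_eq_sub, add_assoc]

theorem evenZ_translate (q x : Z3) : EvenZ (scale 2 q + x) ↔ EvenZ x := by
  simp only [EvenZ, scale, Prod.fst_add, Prod.snd_add]
  lia

theorem refine_translate (q : Z3) (g : ℕ → Z3) :
    refine (fun k => scale 2 q + g k) = fun k => scale 2 (scale 2 q) + refine g k := by
  funext k
  simp only [refine, curveVertex, evenZ_translate, outVertex_translate, scale_scale, scale_add]
  norm_num
  split_ifs <;> rfl

/-- The one-segment path from `x` to `y`. -/
def edge (x y : Z3) (j : ℕ) : Z3 := if j = 0 then x else y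

theorem refine_congr {g g' : ℕ → Z3} (h0 : g 0 = g' 0) (h1 : g 1 = g' 1) {j : ℕ} (hj : j < 8) :
    refine g j = refine g' j := by
  simp only [refine, Nat.div_eq_of_lt hj, h0, zero_add, h1]

/-- The representative in `{0, 1}³` of a point modulo `2`. -/
def parityZ (x : Z3) : Z3 := (x.1 % 2, x.2.1 % 2, x.2.2 % 2)

theorem scale_halfZ_add_parityZ (x : Z3) : scale 2 (halfZ x) + parityZ x = x := by
  ext <;> simp [scale, halfZ, parityZ, Int.mul_ediv_add_emod]

theorem parityZ_mem (x : Z3) : parityZ x ∈ ([0, 1] ×ˢ [0, 1] ×ˢ [0, 1] : List Z3) := by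
  rcases Int.emod_two_eq x.1 with h0 | h0 <;> rcases Int.emod_two_eq x.2.1 with h1 | h1 <;>
    rcases Int.emod_two_eq x.2.2 with h2 | h2 <;> simp [parityZ, h0, h1, h2]

/-- Oriented segments whose image in `𝒞²` passes three times through some point. -/
def tripleEdges : List (Z3 × Z3) :=
  [((0, 0, 0), (-1, 0, 0)), ((0, 0, 0), (0, -1, 0)), ((0, 0, 0), (0, 0, -1)),
    ((0, 0, 1), (0, -1, 1)), ((0, 1, 0), (-1, 1, 0)), ((1, 0, 0), (1, 0, -1))]

theorem exists_triple_of_mem : ∀ p ∈ tripleEdges,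
    ∃ t ∈ ([(14, 28, 36), (10, 22, 34)] : List (ℕ × ℕ × ℕ)),
      refine (refine (edge p.1 p.2)) t.2.1 = refine (refine (edge p.1 p.2)) t.1 ∧
      refine (refine (edge p.1 p.2)) t.2.2 = refine (refine (edge p.1 p.2)) t.1 := by
  decide +kernel

theorem exists_tripleEdge_of_parity : ∀ r ∈ ([0, 1] ×ˢ [0, 1] ×ˢ [0, 1] : List Z3), ∀ i,
    ∃ m ∈ [0, 3], (parityZ (refine (refine (edge r (r + unitZ i))) m),
      parityZ (refine (refine (edge r (r + unitZ i))) m) +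
        (refine (refine (edge r (r + unitZ i))) (m + 1) -
          refine (refine (edge r (r + unitZ i))) m)) ∈ tripleEdges := by
  decide +kernel

theorem blockZ_spec : ∀ i : Fin 4, ∀ M ∈ blockZ i, M.length = 9 ∧
    ∀ j < 7, ¬ ((M.getD (j + 1) 0).1 % 2 = 0 ∧ (M.getD (j + 1) 0).2.1 % 2 = 0 ∧
      (M.getD (j + 1) 0).2.2 % 2 = 0) := by
  decide +kernel

theorem blockTo_spec : ∀ i : Fin 4, ∀ k : Fin 3, ∀ d ∈ [unitZ k, -unitZ k],
    blockTo i (scale 2 (rep i + d)) ∈ blockZ i ∧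
    (blockTo i (scale 2 (rep i + d))).getD 0 0 = scale 2 (rep i) ∧
    (blockTo i (scale 2 (rep i + d))).getD 8 0 = scale 2 (rep i + d) := by
  decide +kernel

theorem edge_translate (q x y : Z3) :
    edge (scale 2 q + x) (scale 2 q + y) = fun k => scale 2 q + edge x y k := by
  funext k
  simp only [edge]
  split <;> rfl

theorem refine_refine_edge_translate (q x y : Z3) :
    refine (refine (edge (scale 2 q + x) (scale 2 q + y))) =
      fun k => scale 2 (scale 2 (scale 2 q)) + refine (refine (edge x y)) k := by
  rw [edge_translate, refine_translate, refine_translate]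

theorem exists_triple {x y : Z3} (h : (parityZ x, parityZ x + (y - x)) ∈ tripleEdges) :
    ∃ j₁ j₂ j₃ : ℕ, j₁ < j₂ ∧ j₂ < j₃ ∧ j₃ ≤ 64 ∧
      refine (refine (edge x y)) j₂ = refine (refine (edge x y)) j₁ ∧
      refine (refine (edge x y)) j₃ = refine (refine (edge x y)) j₁ := by
  obtain ⟨t, ht, h2, h3⟩ := exists_triple_of_mem _ h
  have hxy : edge x y = edge (scale 2 (halfZ x) + parityZ x)
      (scale 2 (halfZ x) + (parityZ x + (y - x))) := by
    rw [← add_assoc, scale_halfZ_add_parityZ, add_sub_cancel]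
  refine ⟨t.1, t.2.1, t.2.2, ?_, ?_, ?_, ?_, ?_⟩
  iterate 3
    simp only [List.mem_cons, List.not_mem_nil, or_false] at ht
    rcases ht with rfl | rfl <;> simp
  all_goals simp only [hxy, refine_refine_edge_translate, h2, h3]

theorem exists_tripleEdge (x : Z3) (i : Fin 3) : ∃ m < 64,
    (parityZ (refine (refine (edge x (x + unitZ i))) m),
      parityZ (refine (refine (edge x (x + unitZ i))) m) +
        (refine (refine (edge x (x + unitZ i))) (m + 1) -
          refine (refine (edge x (x + unitZ i))) m)) ∈ tripleEdges := by
  obtain ⟨m, hm, h⟩ := exists_tripleEdge_of_parity _ (parityZ_mem x) i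
  have hx : edge x (x + unitZ i) = edge (scale 2 (halfZ x) + parityZ x)
      (scale 2 (halfZ x) + (parityZ x + unitZ i)) := by
    rw [← add_assoc, scale_halfZ_add_parityZ]
  have hpar : ∀ q v : Z3, parityZ (scale 2 q + v) = parityZ v := by
    intro q v
    simp [parityZ, scale, Int.mul_add_emod_self_left]
  refine ⟨m, ?_, ?_⟩
  · simp only [List.mem_cons, List.not_mem_nil, or_false] at hm
    rcases hm with rfl | rfl <;> simp
  · rw [hx, refine_refine_edge_translate]
    simpa only [hpar, add_sub_add_left_eq_sub] using h

theorem getD_map_toPt (M : List Z3) (j : ℕ) : (M.map toPt).getD j 0 = toPt (M.getD j 0) := by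
  rw [← toPt_zero, List.getD_map]

theorem isPath_CTrace {i : Fin 4} {M : List Z3} (hM : M ∈ blockZ i) (q : Z3) :
    IsPath CTrace (fun j => toPt (scale 4 q + M.getD j 0)) 8 := by
  have hmem : M.map toPt ∈ blockLists i := by
    rw [blockLists_eq]
    exact List.mem_map_of_mem hM
  have hlen := (blockZ_spec i M hM).1
  have hv : ∀ j, toPt (scale 4 q + M.getD j 0) = (M.map toPt).getD j 0 + (4 : ℝ) • toPt q := by
    intro j
    rw [getD_map_toPt, toPt_add, toPt_scale, add_comm]
    norm_num
  constructor
  · intro j hj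
    refine ⟨toPt q, latt_toPt q, i, _, hmem, _, ⟨j, by simp [hlen]; lia, rfl⟩, ?_⟩
    simp only [hv, Sym2.map_mk]
  · intro j hj
    refine ⟨toPt q, latt_toPt q, i, _, hmem, _, _, ⟨j, by simp [hlen]; lia, Or.inl ⟨rfl, rfl⟩⟩,
      ?_, ?_⟩ <;> simp only [hv, Sym2.map_mk]

theorem eq_of_sym2_eq {α : Type*} {a b d a' b' d' : α} (h : s(a, b) = s(a', b'))
    (h' : s(b, d) = s(b', d')) (had : a ≠ d) : b = b' := by
  rcases Sym2.eq_iff.1 h with ⟨-, h⟩ | ⟨h1, h2⟩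
  · exact h
  · rcases Sym2.eq_iff.1 h' with ⟨h, -⟩ | ⟨-, h4⟩
    · exact h
    · exact absurd (h1.trans h4.symm) had

/-- The connexions of `𝒞` do not occur at points of `2ℤ³`. -/
theorem ne_of_CTrace_conn {a b d : Pt 3} (h : CTrace.conn s(a, b) s(b, d)) (had : a ≠ d)
    (z : Z3) : b ≠ toPt (scale 2 z) := by
  obtain ⟨u, hu, i, L, hL, A, B, ⟨j, hj, hAB⟩, hA, hB⟩ := h
  rw [blockLists_eq] at hL
  obtain ⟨M, hM, rfl⟩ := List.mem_map.1 hL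
  obtain ⟨q, rfl⟩ := exists_toPt_of_latt hu
  obtain ⟨hlen, hodd⟩ := blockZ_spec i M hM
  have hb : b = toPt (M.getD (j + 1) 0 + scale 4 q) := by
    have hw : toPt (M.getD (j + 1) 0 + scale 4 q) =
        (M.map toPt).getD (j + 1) 0 + (4 : ℝ) • toPt q := by
      rw [getD_map_toPt, toPt_add, toPt_scale]
      norm_num
    rw [hw]
    rcases hAB with ⟨rfl, rfl⟩ | ⟨rfl, rfl⟩ <;> rw [Sym2.map_mk] at hA hB
    · exact eq_of_sym2_eq hA hB had
    · exact eq_of_sym2_eq (hA.trans Sym2.eq_swap) (hB.trans Sym2.eq_swap) had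
  rw [hb]
  intro h
  have h := toPt_injective h
  refine hodd j (by simp [hlen] at hj; lia) ?_
  have h0 := congrArg (fun v : Z3 => v.1) h
  have h1 := congrArg (fun v : Z3 => v.2.1) h
  have h2 := congrArg (fun v : Z3 => v.2.2) h
  simp only [scale, Prod.fst_add, Prod.snd_add] at h0 h1 h2
  lia

theorem scale_halfZ_add_rep {x : Z3} (h : EvenZ x) :
    scale 2 (halfZ x) + rep (blockIdx x) = x := by
  simp only [EvenZ] at h
  unfold blockIdx
  split_ifs <;> ext <;> simp [scale, halfZ, rep] <;> lia

theorem AdjZ.sub_mem {x y : Z3} (h : AdjZ x y) : ∃ i, y - x ∈ [unitZ i, -unitZ i] := by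
  obtain ⟨i, rfl | rfl⟩ := h <;> exact ⟨i, by simp⟩

theorem outVertex_spec {x y : Z3} (hx : EvenZ x) (h : AdjZ x y) :
    IsPath CTrace (fun j => toPt (outVertex x y j)) 8 ∧ outVertex x y 0 = scale 2 x ∧
      outVertex x y 8 = scale 2 y := by
  obtain ⟨i, hi⟩ := h.sub_mem
  obtain ⟨hM, h0, h8⟩ := blockTo_spec (blockIdx x) i _ hi
  have e : (4 : ℤ) = 2 * 2 := rfl
  refine ⟨isPath_CTrace hM _, ?_, ?_⟩
  · rw [outVertex, h0, e, ← scale_scale, ← scale_add, scale_halfZ_add_rep hx]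
  · rw [outVertex, h8, e, ← scale_scale, ← scale_add, ← add_assoc, scale_halfZ_add_rep hx,
      add_sub_cancel]

theorem AdjZ.even_of_not_even {x y : Z3} (h : AdjZ x y) (hx : ¬ EvenZ x) : EvenZ y := by
  obtain ⟨i, rfl | rfl⟩ := h <;> fin_cases i <;> simp [EvenZ, unitZ] at hx ⊢ <;> lia

theorem IsPath.reverse {n : ℕ} {T : Trace n} (hT : ∀ S S', T.conn S S' → T.conn S' S)
    {g : ℕ → Pt n} {m : ℕ} (h : IsPath T g m) : IsPath T (fun j => g (m - j)) m := by
  constructor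
  · intro j hj
    obtain ⟨l, rfl⟩ : ∃ l, m = l + (j + 1) := ⟨m - (j + 1), by lia⟩
    have := h.seg l (by lia)
    rw [Sym2.eq_swap]
    convert this using 4 <;> lia
  · intro j hj
    obtain ⟨l, rfl⟩ : ∃ l, m = l + (j + 2) := ⟨m - (j + 2), by lia⟩
    have := hT _ _ (h.conn l (by lia))
    rw [Sym2.eq_swap, Sym2.eq_swap (b := g (l + (j + 2) - (j + 2)))]
    convert this using 4 <;> lia

theorem CTrace_conn_symm (S T : Sym2 (Pt 3)) (h : CTrace.conn S T) : CTrace.conn T S := by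
  obtain ⟨u, hu, i, L, hL, A, B, ⟨j, hj, hAB⟩, hA, hB⟩ := h
  exact ⟨u, hu, i, L, hL, B, A, ⟨j, hj, hAB.symm⟩, hB, hA⟩

theorem curveVertex_spec {x y : Z3} (h : AdjZ x y) :
    IsPath CTrace (fun j => toPt (curveVertex x y j)) 8 ∧ curveVertex x y 0 = scale 2 x ∧
      curveVertex x y 8 = scale 2 y := by
  by_cases hx : EvenZ x
  · obtain ⟨h1, h2, h3⟩ := outVertex_spec hx h
    have hv : curveVertex x y = outVertex x y := by
      funext j
      by_cases hj : j = 0 <;> simp [curveVertex, hx, hj, h2]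
    rw [hv]
    exact ⟨h1, h2, h3⟩
  · obtain ⟨h1, h2, h3⟩ := outVertex_spec (h.even_of_not_even hx) h.symm
    have hv : curveVertex x y = fun j => outVertex y x (8 - j) := by
      funext j
      by_cases hj : j = 0 <;> simp [curveVertex, hx, hj, h3]
    rw [hv]
    exact ⟨h1.reverse CTrace_conn_symm, h3, h2⟩

namespace Curve

variable {n : ℕ} {c : Curve n}

theorem endSegAt_of_notMem {i e : ℤ} (he : e = 1 ∨ e = -1) (h : i ∈ c.dom) (h' : i + e ∈ c.dom)
    (hn : i - e ∉ c.dom) : c.endSegAt (c.v i) s(c.v i, c.v (i + e)) := by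
  rcases he with rfl | rfl
  · exact ⟨i, h, rfl, Or.inl ⟨hn, h', rfl⟩⟩
  · exact ⟨i, h, rfl, Or.inr ⟨by simpa using hn, h', Sym2.eq_swap⟩⟩

theorem isEndpt_of_endSegAt {p : Pt n} {S : Sym2 (Pt n)} (h : c.endSegAt p S) : c.IsEndpt p := by
  obtain ⟨i, hi, hp, h | h⟩ := h
  exacts [⟨i, hi, hp, Or.inl h.1⟩, ⟨i, hi, hp, Or.inr h.1⟩]

theorem exists_eq_of_mem_dom {k e : ℤ} {m : ℕ} (he : e = 1 ∨ e = -1) (h0 : k ∈ c.dom)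
    (hm : k + e * m ∈ c.dom) (h0' : k - e ∉ c.dom) (hm' : k + e * m + e ∉ c.dom) {i : ℤ}
    (hi : i ∈ c.dom) : ∃ j : ℕ, j ≤ m ∧ i = k + e * j := by
  by_contra! hcon
  have hlt : e * (i - k) < 0 ∨ m < e * (i - k) := by
    by_contra! hle
    have h1 := hcon (e * (i - k)).toNat (by lia)
    rw [Int.toNat_of_nonneg hle.1] at h1
    rcases he with rfl | rfl <;> lia
  rcases he with rfl | rfl <;> rcases hlt with hlt | hlt
  · exact h0' (mem_dom_of_between hi h0 (by lia) (by lia))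
  · exact hm' (mem_dom_of_between hm hi (by lia) (by lia))
  · exact h0' (mem_dom_of_between h0 hi (by lia) (by lia))
  · exact hm' (mem_dom_of_between hi hm (by lia) (by lia))

end Curve

theorem refine_eq_curveVertex {g : ℕ → Z3} {l : ℕ} (h : AdjZ (g l) (g (l + 1))) {i : ℕ}
    (hi : i ≤ 8) : refine g (8 * l + i) = curveVertex (g l) (g (l + 1)) i := by
  rcases hi.lt_or_eq with hi | rfl
  · rw [refine, show (8 * l + i) / 8 = l by lia, show (8 * l + i) % 8 = i by lia]
  · rw [refine, show (8 * l + 8) / 8 = l + 1 by lia, show (8 * l + 8) % 8 = 0 by lia,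
      (curveVertex_spec h).2.2]
    rfl

theorem two_smul_toPt (x : Z3) : ((2 : ℕ) : ℝ) • toPt x = toPt (scale 2 x) := by
  rw [toPt_scale]
  norm_num

section Covering

variable {C3 : Set (Curve 3)}

theorem exists_curve_between (hC3 : traceOf C3 = CTrace) (hD : DisjSA C3) {x y : Z3}
    (h : AdjZ x y) :
    ∃ c ∈ C3,
      c.endSegAt (toPt (scale 2 x)) s(toPt (curveVertex x y 0), toPt (curveVertex x y 1)) ∧
      c.endSegAt (toPt (scale 2 y)) s(toPt (curveVertex x y 7), toPt (curveVertex x y 8)) ∧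
      IsPath (curveTrace c) (fun j => toPt (curveVertex x y j)) 8 ∧
      ∀ S ∈ c.segs, ∃ j < 8, S = s(toPt (curveVertex x y j), toPt (curveVertex x y (j + 1))) := by
  obtain ⟨hpath, h0, h8⟩ := curveVertex_spec h
  rw [← hC3] at hpath
  obtain ⟨c, hc, k, e, he, hv⟩ := hpath.exists_curve hD (by norm_num)
  have hne : ∀ i e : ℤ, (e = 1 ∨ e = -1) → ∀ z, c.v i = toPt (scale 2 z) →
      i + e ∈ c.dom → i - e ∉ c.dom := by
    intro i e he z hz h1 h2
    have e2 : i - e + 2 * e = i + e := by ring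
    have h1' : i - e + 2 * e ∈ c.dom := by rwa [e2]
    have hconn := Curve.conn_mem he h2 h1'
    have hvne := Curve.v_add_two_ne he h2 h1'
    rw [e2, sub_add_cancel] at hconn
    rw [e2] at hvne
    have : CTrace.conn s(c.v (i - e), c.v i) s(c.v i, c.v (i + e)) := by
      rw [← hC3]
      exact ⟨c, hc, hconn⟩
    exact ne_of_CTrace_conn this hvne.symm z hz
  have hdom : ∀ j : ℕ, j ≤ 8 → k + e * j ∈ c.dom := fun j hj => (hv j hj).1
  have hval : ∀ j : ℕ, j ≤ 8 → c.v (k + e * j) = toPt (curveVertex x y j) :=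
    fun j hj => (hv j hj).2
  have hsucc : ∀ j : ℕ, k + e * (j + 1 : ℕ) = k + e * j + e := fun j => by push_cast; ring
  have hsucc2 : ∀ j : ℕ, k + e * (j + 2 : ℕ) = k + e * j + 2 * e := fun j => by push_cast; ring
  have hk : k + e * (0 : ℕ) = k := by simp
  have hstart : k - e ∉ c.dom := by
    refine hne k e he x ?_ ?_
    · rw [← h0, ← hval 0 (by norm_num), hk]
    · have := hdom 1 (by norm_num)
      rwa [hsucc 0, hk] at this
  have e7 : k + e * (8 : ℕ) + -e = k + e * (7 : ℕ) := by push_cast; ring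
  have hend : k + e * (8 : ℕ) + e ∉ c.dom := by
    have := hne (k + e * (8 : ℕ)) (-e) (by lia) y (by rw [hval 8 le_rfl, h8])
      (by rw [e7]; exact hdom 7 (by norm_num))
    rwa [sub_neg_eq_add] at this
  have hd0 : k ∈ c.dom := by simpa using hdom 0 (by norm_num)
  refine ⟨c, hc, ?_, ?_, ⟨?_, ?_⟩, ?_⟩
  · rw [← h0, ← hval 0 (by norm_num), ← hval 1 (by norm_num), hsucc 0, hk]
    exact Curve.endSegAt_of_notMem he hd0 (by simpa using hdom 1 (by norm_num)) hstart
  · rw [← h8, ← hval 7 (by norm_num), ← hval 8 (by norm_num), ← e7, Sym2.eq_swap]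
    exact Curve.endSegAt_of_notMem (by lia) (hdom 8 le_rfl) (by rw [e7]; exact hdom 7 (by norm_num))
      (by rwa [sub_neg_eq_add])
  · intro j hj
    rw [← hval j (by lia), ← hval (j + 1) (by lia), hsucc]
    exact Curve.seg_mem he (hdom j (by lia)) (by rw [← hsucc]; exact hdom _ (by lia))
  · intro j hj
    rw [← hval j (by lia), ← hval (j + 1) (by lia), ← hval (j + 2) (by lia), hsucc, hsucc2]
    exact Curve.conn_mem he (hdom j (by lia)) (by rw [← hsucc2]; exact hdom _ (by lia))
  · rintro _ ⟨i, hi, hi', rfl⟩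
    obtain ⟨j, hj, rfl⟩ := Curve.exists_eq_of_mem_dom he hd0 (hdom 8 le_rfl) hstart hend hi
    obtain ⟨l, hl, hjl⟩ := Curve.exists_eq_of_mem_dom he hd0 (hdom 8 le_rfl) hstart hend hi'
    rw [hjl, hval j hj, hval l hl]
    rcases he with rfl | rfl
    · obtain rfl : l = j + 1 := by lia
      exact ⟨j, by lia, rfl⟩
    · obtain rfl : j = l + 1 := by lia
      exact ⟨l, by lia, Sym2.eq_swap⟩

theorem SatH.sameCurve {l : ℕ} (hH : SatH C3 2 l) {x y : Z3} (h : AdjZ x y) {c d : Curve 3}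
    (hc : c ∈ C3) (hd : d ∈ C3) (hcx : c.IsEndpt (toPt (scale 2 x)))
    (hcy : c.IsEndpt (toPt (scale 2 y))) (hdx : d.IsEndpt (toPt (scale 2 x)))
    (hdy : d.IsEndpt (toPt (scale 2 y))) : SameCurve c d := by
  have key : ∀ z i, toPt (scale 2 (z + unitZ i)) =
      toPt (scale 2 z) + ((2 : ℕ) : ℝ) • uvec 3 i := by
    intro z i
    rw [← toPt_unitZ, two_smul_toPt, ← toPt_add, scale_add]
  have huniq := fun z i => (hH.2.2.2.2.2.1 (toPt (scale 2 z)) i (latt_toPt _)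
    (inLat_toPt_scale 2 z)).2 c hc d hd
  obtain ⟨i, rfl | rfl⟩ := h
  · rw [key] at hcy hdy
    exact huniq x i hcx hcy hdx hdy
  · rw [key] at hcx hdx
    exact huniq y i hcy hcx hdy hdx

theorem adjZ_of_mem_segs {B : Set (Curve 3)} {x y : Z3}
    (h : s(toPt x, toPt y) ∈ (traceOf B).segs) : AdjZ x y := by
  obtain ⟨c, -, i, hi, hi', h⟩ := h
  obtain ⟨j, hj⟩ := c.step i hi hi'
  have key : ∀ z w : Z3, toPt w = toPt z + uvec 3 j → w = z + unitZ j := by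
    intro z w hw
    rw [← toPt_unitZ, ← toPt_add] at hw
    exact toPt_injective hw
  rcases Sym2.eq_iff.1 h with ⟨h1, h2⟩ | ⟨h1, h2⟩ <;> rw [← h1, ← h2] at hj <;>
    rcases hj with hj | hj
  · exact ⟨j, Or.inl (key _ _ hj)⟩
  · exact ⟨j, Or.inr (key _ _ (by rw [hj]; abel))⟩
  · exact ⟨j, Or.inr (key _ _ hj)⟩
  · exact ⟨j, Or.inl (key _ _ (by rw [hj]; abel))⟩

theorem IsPath.refine (hC3 : traceOf C3 = CTrace) (hD : DisjSA C3) {B : Set (Curve 3)}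
    {g : ℕ → Z3} {m : ℕ} (hg : IsPath (traceOf B) (fun j => toPt (g j)) m) :
    IsPath (ConvTrace 2 C3 B) (fun j => toPt (Folding.refine g j)) (8 * m) := by
  have hadj : ∀ j < m, AdjZ (g j) (g (j + 1)) := fun j hj => adjZ_of_mem_segs (hg.seg j hj)
  have hr : ∀ l < m, ∀ i ≤ 8, Folding.refine g (8 * l + i) = curveVertex (g l) (g (l + 1)) i :=
    fun l hl i hi => refine_eq_curveVertex (hadj l hl) hi
  rcases m.eq_zero_or_pos with rfl | hm
  · exact ⟨by simp, by simp⟩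
  have : Nonempty (Curve 3) := ⟨(hg.seg 0 hm).choose⟩
  choose! c hc hstart hend hpath hsegs using fun l hl => exists_curve_between hC3 hD (hadj l hl)
  have hx : ∀ l < m, (c l).IsEndpt (((2 : ℕ) : ℝ) • toPt (g l)) := fun l hl => by
    rw [two_smul_toPt]
    exact Curve.isEndpt_of_endSegAt (hstart l hl)
  have hy : ∀ l < m, (c l).IsEndpt (((2 : ℕ) : ℝ) • toPt (g (l + 1))) := fun l hl => by
    rw [two_smul_toPt]
    exact Curve.isEndpt_of_endSegAt (hend l hl)
  constructor
  · intro j hj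
    obtain ⟨l, i, hi, rfl⟩ : ∃ l i, i < 8 ∧ j = 8 * l + i := ⟨j / 8, j % 8, by lia, by lia⟩
    have hl : l < m := by lia
    refine ⟨_, _, hg.seg l hl, c l, hc l hl, hx l hl, hy l hl, ?_⟩
    simp only [add_assoc]
    rw [hr l hl i hi.le, hr l hl (i + 1) hi]
    exact (hpath l hl).seg i hi
  · intro j hj
    obtain ⟨l, i, hi, rfl⟩ : ∃ l i, i < 8 ∧ j = 8 * l + i := ⟨j / 8, j % 8, by lia, by lia⟩
    have hl : l < m := by lia
    rcases (show i < 7 ∨ i = 7 by lia) with hi | rfl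
    · refine Or.inl ⟨_, _, hg.seg l hl, c l, hc l hl, hx l hl, hy l hl, ?_⟩
      simp only [add_assoc]
      rw [hr l hl i (by lia), hr l hl (i + 1) (by lia), hr l hl (i + 2) (by lia)]
      exact (hpath l hl).conn i (by lia)
    · have hl' : l + 1 < m := by lia
      refine Or.inr ⟨_, _, _, hg.conn l hl', c l, hc l hl, c (l + 1), hc _ hl', hx l hl, hy l hl,
        hx _ hl', hy _ hl', Or.inl ⟨?_, ?_⟩⟩
      · rw [two_smul_toPt, hr l hl 7 (by norm_num), show 8 * l + 7 + 1 = 8 * l + 8 by ring,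
          hr l hl 8 le_rfl]
        exact hend l hl
      · rw [two_smul_toPt, show 8 * l + 7 + 1 = 8 * (l + 1) + 0 by ring,
          show 8 * l + 7 + 2 = 8 * (l + 1) + 1 by ring, hr _ hl' 0 (by norm_num),
          hr _ hl' 1 (by norm_num)]
        exact hstart _ hl'

end Covering

section Powers

variable {C3 : Set (Curve 3)} {P : ℕ → Set (Curve 3)}

theorem PowersOf.isPath_iterate_refine (hP : PowersOf C3 2 P) (hC3 : traceOf C3 = CTrace)
    (hD : DisjSA C3) {s t : ℕ} {g : ℕ → Z3} {m : ℕ}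
    (hg : IsPath (traceOf (P s)) (fun j => toPt (g j)) m) :
    IsPath (traceOf (P (s + t))) (fun j => toPt (refine^[t] g j)) (8 ^ t * m) := by
  induction t with
  | zero => simpa using hg
  | succ t ih =>
    rw [← add_assoc, hP.2.2, Function.iterate_succ_apply', pow_succ', mul_assoc]
    exact ih.refine hC3 hD

theorem PowersOf.isPath_edge (hP : PowersOf C3 2 P) {x y : Z3} (h : AdjZ x y) :
    IsPath (traceOf (P 0)) (fun j => toPt (edge x y j)) 1 := by
  rw [hP.2.1]
  refine ⟨fun j hj => ?_, fun j hj => absurd hj (by lia)⟩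
  obtain rfl : j = 0 := by lia
  obtain ⟨i, rfl | rfl⟩ := h
  · exact ⟨toPt x, i, latt_toPt x, by simp [edge, toPt_add, toPt_unitZ]⟩
  · exact ⟨toPt y, i, latt_toPt y, by simp [edge, toPt_add, toPt_unitZ, Sym2.eq_swap]⟩

theorem PowersOf.exists_edge (hP : PowersOf C3 2 P) (hC3 : traceOf C3 = CTrace)
    (hH : SatH C3 2 4) (s : ℕ) : ∀ S ∈ (traceOf (P s)).segs, ∃ (x : Z3) (i : Fin 3),
      ∃ j < 8 ^ s, S = s(toPt (refine^[s] (edge x (x + unitZ i)) j),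
        toPt (refine^[s] (edge x (x + unitZ i)) (j + 1))) := by
  induction s with
  | zero =>
    intro S hS
    rw [hP.2.1] at hS
    obtain ⟨x, i, hx, rfl⟩ := hS
    obtain ⟨z, rfl⟩ := exists_toPt_of_latt hx
    exact ⟨z, i, 0, by simp, by simp [edge, toPt_add, toPt_unitZ]⟩
  | succ s ih =>
    intro S hS
    rw [hP.2.2] at hS
    obtain ⟨a, b, hab, c, hc, ha, hb, hS⟩ := hS
    obtain ⟨x, i, j, hj, hS'⟩ := ih _ hab
    rw [hS'] at hab
    have hadj := adjZ_of_mem_segs hab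
    refine ⟨x, i, ?_⟩
    rw [Function.iterate_succ_apply']
    generalize refine^[s] (edge x (x + unitZ i)) = g at *
    obtain ⟨d, hd, h0, h8, -, hsegs⟩ := exists_curve_between hC3 hH.2.2.2.1.1 hadj
    have hcd : SameCurve c d := by
      have h0 := Curve.isEndpt_of_endSegAt h0
      have h8 := Curve.isEndpt_of_endSegAt h8
      rcases Sym2.eq_iff.1 hS' with ⟨rfl, rfl⟩ | ⟨rfl, rfl⟩ <;> rw [two_smul_toPt] at ha hb
      exacts [hH.sameCurve hadj hc hd ha hb h0 h8, hH.sameCurve hadj hc hd hb ha h0 h8]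
    rw [hcd.1] at hS
    obtain ⟨l, hl, rfl⟩ := hsegs S hS
    refine ⟨8 * j + l, by rw [pow_succ]; lia, ?_⟩
    rw [add_assoc, refine_eq_curveVertex hadj hl.le, refine_eq_curveVertex hadj hl]

theorem TPrec.convTrace {k : ℕ} {A B B' : Set (Curve 3)} (h : Prec B B') :
    TPrec (ConvTrace k A B) (ConvTrace k A B') := by
  refine ⟨?_, ?_⟩
  · rintro S ⟨a, b, hab, hS⟩
    exact ⟨a, b, h.1 hab, hS⟩
  · rintro S S' (⟨a, b, hab, hS⟩ | ⟨a, b, d, hab, hS⟩)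
    · exact Or.inl ⟨a, b, h.1 hab, hS⟩
    · exact Or.inr ⟨a, b, d, h.2 _ _ hab, hS⟩

theorem PowersOf.prec_succ (hP : PowersOf C3 2 P) (hH : SatH C3 2 4) (s : ℕ) :
    Prec (P s) (P (s + 1)) := by
  induction s with
  | zero =>
    rw [Prec, hP.2.2, hP.2.1]
    refine ⟨fun S hS => ?_, fun _ _ h => h.elim⟩
    have hne : (segPts S ∩ univ).Nonempty := by
      obtain ⟨x, i, -, rfl⟩ := hS
      exact ⟨x, ⟨x, _, rfl, 0, le_rfl, zero_le_one, by simp⟩, trivial⟩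
    obtain ⟨c, hc, hSc⟩ := (hH.2.2.2.1.2 S hS hne).1
    obtain ⟨-, x, i, -, hx, h1, h2, -⟩ := hH.2.2.2.2.1 c hc
    obtain ⟨z, rfl⟩ := exists_toPt_of_inLat hx
    refine ⟨toPt z, toPt z + uvec 3 i, ?_, c, hc, h1, by rwa [smul_add], hSc⟩
    rw [hP.2.1]
    exact ⟨_, i, latt_toPt z, rfl⟩
  | succ s ih =>
    rw [Prec, hP.2.2, hP.2.2 (s + 1)]
    exact TPrec.convTrace ih

theorem Prec.trans {n : ℕ} {E F G : Set (Curve n)} (h : Prec E F) (h' : Prec F G) : Prec E G :=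
  ⟨h.1.trans h'.1, fun _ _ hS => h'.2 _ _ (h.2 _ _ hS)⟩

theorem IsPath.mem_segs_of_exists {n : ℕ} {E : Set (Curve n)} (hE : DisjSA E) {g : ℕ → Pt n}
    {m : ℕ} (hg : IsPath (traceOf E) g m) {c : Curve n} (hc : c ∈ E) {j : ℕ} (hj : j < m)
    (hjc : s(g j, g (j + 1)) ∈ c.segs) {l : ℕ} (hl : l < m) : s(g l, g (l + 1)) ∈ c.segs := by
  obtain ⟨d, hd, k, e, he, h⟩ := hg.exists_curve hE (by lia)
  have hmem : ∀ i < m, s(g i, g (i + 1)) ∈ d.segs := by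
    intro i hi
    have e1 : k + e * ((i + 1 : ℕ) : ℤ) = k + e * i + e := by push_cast; ring
    have h1 := h (i + 1) hi
    have h0 := h i hi.le
    rw [e1] at h1
    rw [← h0.2, ← h1.2]
    exact Curve.seg_mem he h0.1 h1.1
  rw [(hE.sameCurve hc hd hjc (hmem j hj)).1]
  exact hmem l hl

theorem refine_refine_eq_edge (g : ℕ → Z3) (m : ℕ) {j : ℕ} (hj : j < 8) :
    refine (refine g) (64 * m + j) = refine (refine (edge (g m) (g (m + 1)))) j := by
  have h : ∀ i < 8, refine (fun k => g (m + k)) i = refine (edge (g m) (g (m + 1))) i :=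
    fun i hi => refine_congr (g := fun k => g (m + k)) (g' := edge _ _) rfl rfl hi
  rw [← refine_congr (h 0 (by norm_num)) (h 1 (by norm_num)) hj, refine_shift, refine_shift,
    ← mul_assoc]
  rfl

end Powers

/-- Lemma 2.2: each curve of `𝒞⁴` contains a curve of `𝒞²` which passes
`3` times through some point. -/
theorem statement9 (C3 : Set (Curve 3)) (hC3 : traceOf C3 = CTrace)
    (hH : SatH C3 2 4) (P : ℕ → Set (Curve 3)) (hP : PowersOf C3 2 P) :
    ∀ a ∈ P 4, ∃ b ∈ P 2, SubCurve b a ∧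
      ∃ (p : Pt 3) (i1 i2 i3 : ℤ), i1 ∈ b.dom ∧ i2 ∈ b.dom ∧ i3 ∈ b.dom ∧
        i1 < i2 ∧ i2 < i3 ∧ b.v i1 = p ∧ b.v i2 = p ∧ b.v i3 = p := by
  intro a ha
  have hD : DisjSA C3 := hH.2.2.2.1.1
  have hprec : Prec (P 2) (P 4) := (hP.prec_succ hH 2).trans (hP.prec_succ hH 3)
  obtain ⟨i, hi, hi'⟩ := a.nontriv
  have hS : s(a.v i, a.v (i + 1)) ∈ a.segs := ⟨i, hi, hi', rfl⟩
  obtain ⟨x, k, j, hj, hSj⟩ := hP.exists_edge hC3 hH 4 _ ⟨a, ha, hS⟩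
  rw [hSj] at hS
  have hpath2 := hP.isPath_iterate_refine hC3 hD (t := 2)
    (hP.isPath_edge (x := x) (y := x + unitZ k) ⟨k, Or.inl rfl⟩)
  have hpath4 := hP.isPath_iterate_refine hC3 hD (t := 2) hpath2
  obtain ⟨m, hm, htriple⟩ := exists_tripleEdge x k
  have hadj := adjZ_of_mem_segs (hpath2.seg m (by lia))
  have hpath := hP.isPath_iterate_refine hC3 hD (t := 2) (hP.isPath_edge hadj)
  obtain ⟨b, hb, l, e, he, hv⟩ := hpath.exists_curve (hP.1 _) (by norm_num)
  obtain ⟨j₁, j₂, j₃, h12, h23, h3, e2, e3⟩ := exists_triple htriple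
  have hval : ∀ j : ℕ, j ≤ 64 → l + e * j ∈ b.dom ∧ b.v (l + e * j) =
      toPt (refine (refine (edge (refine (refine (edge x (x + unitZ k))) m)
        (refine (refine (edge x (x + unitZ k))) (m + 1)))) j) := fun j hj => hv j (by lia)
  refine ⟨b, hb, ?_, ?_⟩
  · have hSb : s(b.v (l + e * (0 : ℕ)), b.v (l + e * (1 : ℕ))) ∈ b.segs := by
      have := hval 0 (by norm_num)
      have := hval 1 (by norm_num)
      simp only [Nat.cast_zero, mul_zero, add_zero, Nat.cast_one, mul_one] at *
      exact Curve.seg_mem he (by tauto) (by tauto)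
    rw [(hval 0 (by norm_num)).2, (hval 1 (by norm_num)).2,
      ← refine_refine_eq_edge _ _ (by norm_num), ← refine_refine_eq_edge _ _ (by norm_num)] at hSb
    exact hprec.subCurve (hP.1 4) hb ha hSb
      (hpath4.mem_segs_of_exists (hP.1 4) ha (by lia) hS (l := 64 * m) (by lia))
  · obtain ⟨d1, v1⟩ := hval j₁ (by lia)
    obtain ⟨d2, v2⟩ := hval j₂ (by lia)
    obtain ⟨d3, v3⟩ := hval j₃ (by lia)
    rw [e2] at v2
    rw [e3] at v3
    rcases he with rfl | rfl
    · exact ⟨_, _, _, _, d1, d2, d3, by lia, by lia, v1, v2, v3⟩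
    · exact ⟨_, _, _, _, d3, d2, d1, by lia, by lia, v3, v2, v1⟩

end
end Folding
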